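/- Let U ∈ G with v₁ = m₁/ρ, sound speed a = √(γ p(U)/ρ), and let α > |v₁|. Then for each sign choice ±, the recovered internal energy ρe(U ± (1/α)F₁(U)) is positive if and only if ((γ−1)/(2γ)) a² < (α ± v₁)². In particular, if α ≥ |v₁| + a then both recovered internal energies are positive. -/

import Mathlib

noncomputable section

/-- Internal energy density `ρe` of a 2D Euler conservative state `W = (ρ, m₁, m₂, E)`. -/
def internalEnergy (W : Fin 4 → ℝ) : ℝ :=
  W 3 - ((W 1) ^ 2 + (W 2) ^ 2) / (2 * W 0)

/-- Perfect-gas pressure. -/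
def eulerPressure (γ : ℝ) (U : Fin 4 → ℝ) : ℝ :=
  (γ - 1) * internalEnergy U

/-- x-directional Euler flux. -/
def eulerFlux1 (γ : ℝ) (U : Fin 4 → ℝ) : Fin 4 → ℝ :=
  ![U 1, (U 1) ^ 2 / U 0 + eulerPressure γ U, U 1 * U 2 / U 0,
    (U 3 + eulerPressure γ U) * (U 1 / U 0)]

/-- Sound speed. -/
def soundSpeed (γ : ℝ) (U : Fin 4 → ℝ) : ℝ :=
  Real.sqrt (γ * eulerPressure γ U / U 0)

theorem internalEnergy_add_smul_eulerFlux1 (γ s : ℝ) (U : Fin 4 → ℝ) (hρ : 0 < U 0)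
    (hc : 0 < 1 + s * (U 1 / U 0)) :
    internalEnergy (U + s • eulerFlux1 γ U) =
      (1 + s * (U 1 / U 0)) * internalEnergy U -
        s ^ 2 * eulerPressure γ U ^ 2 / (2 * (U 0 * (1 + s * (U 1 / U 0)))) := by
  obtain ⟨v, hv⟩ : ∃ v, v = U 1 / U 0 := ⟨_, rfl⟩
  have hm : U 1 = U 0 * v := by rw [hv]; field_simp
  rw [← hv] at hc ⊢
  have hρ' := hρ.ne'
  have hc' := hc.ne'
  generalize hP : eulerPressure γ U = P
  have h0 : (U + s • eulerFlux1 γ U) 0 = U 0 * (1 + s * v) := by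
    simp [eulerFlux1, hm]; ring
  have h1 : (U + s • eulerFlux1 γ U) 1 = U 0 * v * (1 + s * v) + s * P := by
    simp [eulerFlux1, hm, hP]; field_simp; ring
  have h2 : (U + s • eulerFlux1 γ U) 2 = U 2 * (1 + s * v) := by
    simp [eulerFlux1, hm]; field_simp
  have h3 : (U + s • eulerFlux1 γ U) 3 = U 3 + s * ((U 3 + P) * v) := by
    simp [eulerFlux1, ← hv, hP]
  rw [internalEnergy, h0, h1, h2, h3, internalEnergy, hm]
  field_simp
  ring

theorem soundSpeed_sq_mul (γ : ℝ) (hγ : 1 < γ) (U : Fin 4 → ℝ)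
    (hρ : 0 < U 0) (hp : 0 < eulerPressure γ U) :
    (γ - 1) / (2 * γ) * soundSpeed γ U ^ 2 = (γ - 1) * eulerPressure γ U / (2 * U 0) := by
  have hγ0 : 0 < γ := by linarith
  rw [soundSpeed, Real.sq_sqrt (by positivity)]
  field_simp

theorem internalEnergy_add_smul_eulerFlux1_pos_iff (γ : ℝ) (hγ : 1 < γ) (s : ℝ) (hs : s ≠ 0)
    (U : Fin 4 → ℝ) (hρ : 0 < U 0) (hp : 0 < eulerPressure γ U)
    (hc : 0 < 1 + s * (U 1 / U 0)) :
    0 < internalEnergy (U + s • eulerFlux1 γ U) ↔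
      (γ - 1) / (2 * γ) * soundSpeed γ U ^ 2 < (1 / s + U 1 / U 0) ^ 2 := by
  rw [internalEnergy_add_smul_eulerFlux1 γ s U hρ hc, soundSpeed_sq_mul γ hγ U hρ hp]
  have hγ1 : 0 < γ - 1 := by linarith
  have he : internalEnergy U = eulerPressure γ U / (γ - 1) := by
    rw [eulerPressure]; field_simp
  rw [he]
  generalize eulerPressure γ U = P at hp
  generalize U 1 / U 0 = v at hc
  have key : (1 + s * v) * (P / (γ - 1)) - s ^ 2 * P ^ 2 / (2 * (U 0 * (1 + s * v))) =
      P * s ^ 2 / ((γ - 1) * (1 + s * v)) *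
        ((1 / s + v) ^ 2 - (γ - 1) * P / (2 * U 0)) := by
    have := hc.ne'
    field_simp
  have hk : 0 < P * s ^ 2 / ((γ - 1) * (1 + s * v)) := by positivity
  rw [key, mul_pos_iff_of_pos_left hk, sub_pos]

theorem internal_energy_positivity_iff
    (γ : ℝ) (hγ : 1 < γ) (U : Fin 4 → ℝ)
    (hρ : 0 < U 0) (hp : 0 < eulerPressure γ U)
    (α : ℝ) (hα : |U 1 / U 0| < α) :
    (0 < internalEnergy (U + (1 / α) • eulerFlux1 γ U) ↔
        (γ - 1) / (2 * γ) * (soundSpeed γ U) ^ 2 < (α + U 1 / U 0) ^ 2) ∧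
      (0 < internalEnergy (U - (1 / α) • eulerFlux1 γ U) ↔
        (γ - 1) / (2 * γ) * (soundSpeed γ U) ^ 2 < (α - U 1 / U 0) ^ 2) ∧
      (|U 1 / U 0| + soundSpeed γ U ≤ α →
        0 < internalEnergy (U + (1 / α) • eulerFlux1 γ U) ∧
          0 < internalEnergy (U - (1 / α) • eulerFlux1 γ U)) := by
  have hα0 : 0 < α := (abs_nonneg _).trans_lt hα
  obtain ⟨hl, hr⟩ := abs_lt.mp hα
  have hplus : 0 < internalEnergy (U + (1 / α) • eulerFlux1 γ U) ↔
      (γ - 1) / (2 * γ) * (soundSpeed γ U) ^ 2 < (α + U 1 / U 0) ^ 2 := by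
    have hc : 0 < 1 + 1 / α * (U 1 / U 0) := by
      have h : 1 + 1 / α * (U 1 / U 0) = (α + U 1 / U 0) / α := by field_simp
      rw [h]
      exact div_pos (by linarith) hα0
    rw [internalEnergy_add_smul_eulerFlux1_pos_iff γ hγ (1 / α) (by positivity) U hρ hp hc,
      one_div_one_div]
  have hminus : 0 < internalEnergy (U - (1 / α) • eulerFlux1 γ U) ↔
      (γ - 1) / (2 * γ) * (soundSpeed γ U) ^ 2 < (α - U 1 / U 0) ^ 2 := by
    have hc : 0 < 1 + -(1 / α) * (U 1 / U 0) := by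
      have h : 1 + -(1 / α) * (U 1 / U 0) = (α - U 1 / U 0) / α := by field_simp; ring
      rw [h]
      exact div_pos (by linarith) hα0
    have hs : -(1 / α) ≠ 0 := neg_ne_zero.mpr (by positivity)
    have hsq : (1 / -(1 / α) + U 1 / U 0) ^ 2 = (α - U 1 / U 0) ^ 2 := by
      rw [one_div_neg_eq_neg_one_div, one_div_one_div]
      ring
    rw [sub_eq_add_neg U, ← neg_smul,
      internalEnergy_add_smul_eulerFlux1_pos_iff γ hγ _ hs U hρ hp hc, hsq]
  refine ⟨hplus, hminus, fun h => ?_⟩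
  have hγ0 : 0 < γ := by linarith
  have ha : 0 < soundSpeed γ U := Real.sqrt_pos.mpr (by positivity)
  have hlt : (γ - 1) / (2 * γ) * soundSpeed γ U ^ 2 < soundSpeed γ U ^ 2 := by
    have : (γ - 1) / (2 * γ) < 1 := by
      rw [div_lt_one (by positivity)]
      linarith
    exact mul_lt_of_lt_one_left (by positivity) this
  have h1 := neg_abs_le (U 1 / U 0)
  have h2 := le_abs_self (U 1 / U 0)
  exact ⟨hplus.mpr (hlt.trans_le (pow_le_pow_left₀ ha.le (by linarith) 2)),
    hminus.mpr (hlt.trans_le (pow_le_pow_left₀ ha.le (by linarith) 2))⟩
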